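/- arXiv:math/0405094 — 2 statements merged into one kernel-verified Lean document; each statement's English description precedes it below -/
import Mathlib

section
/- Let C₂(x,y) and D(x,y) be binary cubic forms over ℝ and let d̃ = deg gcd(C₂, D) (over ℂ). Define B₃ = Jacobian(C₂, D), B₂ = (B₃,B₃)^(2) − 6·B₃·(C₂,D)^(3), and B₁ = Res_x(C₂,D)/y⁹. Then: d̃ = 0 iff B₁ ≠ 0; d̃ = 1 iff B₁ = 0 and B₂ ≠ 0; d̃ = 2 iff B₂ = 0 and B₃ ≠ 0; d̃ = 3 iff B₃ = 0. -/
open MvPolynomial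

/-- The transvectant of index `k` of two binary forms `f, g`:
`(f,g)^{(k)} = Σ_{h=0}^{k} (−1)^h·C(k,h)·(∂^k f/∂x^{k−h}∂y^h)·(∂^k g/∂x^h∂y^{k−h})`. -/
noncomputable def transvectant (k : ℕ) (f g : MvPolynomial (Fin 2) ℝ) :
    MvPolynomial (Fin 2) ℝ :=
  ∑ h ∈ Finset.range (k + 1),
    ((-1 : ℝ) ^ h * (Nat.choose k h : ℝ)) •
      (((fun r => pderiv (0 : Fin 2) r)^[k - h] ((fun r => pderiv (1 : Fin 2) r)^[h] f)) *
       ((fun r => pderiv (0 : Fin 2) r)^[h] ((fun r => pderiv (1 : Fin 2) r)^[k - h] g)))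

namespace MvPolynomial

section BinaryForm

variable {R : Type*} [CommRing R]

/-- The binary form `∑ aᵢ x^(n-i) y^i` with coefficient vector `a`. -/
noncomputable def binaryForm {n : ℕ} (a : Fin (n + 1) → R) : MvPolynomial (Fin 2) R :=
  ∑ i, C (a i) * X 0 ^ (n - (i : ℕ)) * X 1 ^ (i : ℕ)

theorem isHomogeneous_binaryForm {n : ℕ} (a : Fin (n + 1) → R) :
    (binaryForm a).IsHomogeneous n := by
  refine IsHomogeneous.sum _ _ _ fun i _ => ?_
  have h := ((isHomogeneous_C_mul_X_pow (a i) (0 : Fin 2) (n - (i : ℕ))).mul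
    (isHomogeneous_X_pow (R := R) (1 : Fin 2) (i : ℕ)))
  rwa [Nat.sub_add_cancel (Nat.lt_succ_iff.mp i.2)] at h

theorem coeff_binaryForm {n : ℕ} (a : Fin (n + 1) → R) (i : Fin (n + 1)) :
    coeff (Finsupp.single 0 (n - (i : ℕ)) + Finsupp.single 1 (i : ℕ)) (binaryForm a) = a i := by
  have hmon : ∀ j : Fin (n + 1), C (a j) * X 0 ^ (n - (j : ℕ)) * X 1 ^ (j : ℕ) =
      monomial (Finsupp.single (0 : Fin 2) (n - (j : ℕ)) + Finsupp.single 1 (j : ℕ)) (a j) := by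
    intro j
    rw [monomial_fin_two]
    simp
  simp only [binaryForm, hmon, coeff_sum, coeff_monomial]
  rw [Finset.sum_eq_single i]
  · simp
  · intro j _ hj
    refine if_neg fun h => hj ?_
    have := DFunLike.congr_fun h 1
    simp at this
    exact Fin.ext this
  · simp

theorem binaryForm_injective {n : ℕ} :
    Function.Injective (binaryForm : (Fin (n + 1) → R) → MvPolynomial (Fin 2) R) := by
  intro a b h
  funext i
  rw [← coeff_binaryForm a i, h, coeff_binaryForm]

theorem binaryForm_eq_zero_iff {n : ℕ} {a : Fin (n + 1) → R} : binaryForm a = 0 ↔ a = 0 := by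
  rw [← binaryForm_injective.eq_iff (a := a) (b := 0)]
  simp [binaryForm]

theorem map_binaryForm {S : Type*} [CommRing S] (φ : R →+* S) {n : ℕ} (a : Fin (n + 1) → R) :
    map φ (binaryForm a) = binaryForm (φ ∘ a) := by
  simp [binaryForm]

theorem IsHomogeneous.exists_eq_binaryForm {n : ℕ} {f : MvPolynomial (Fin 2) R}
    (hf : f.IsHomogeneous n) : ∃ a : Fin (n + 1) → R, f = binaryForm a := by
  refine ⟨fun i => coeff (Finsupp.single 0 (n - (i : ℕ)) + Finsupp.single 1 (i : ℕ)) f, ?_⟩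
  ext s
  by_cases hs : s.degree = n
  · have hsum : s 0 + s 1 = n := by
      rw [← hs, Finsupp.degree_eq_sum]; simp
    have hlt : s 1 < n + 1 := by omega
    have key : s = Finsupp.single 0 (n - ((⟨s 1, hlt⟩ : Fin (n + 1)) : ℕ)) +
        Finsupp.single 1 ((⟨s 1, hlt⟩ : Fin (n + 1)) : ℕ) := by
      ext j
      fin_cases j
      · simp; omega
      · simp
    rw [key, coeff_binaryForm]
  · rw [hf.coeff_eq_zero hs, (isHomogeneous_binaryForm _).coeff_eq_zero hs]

theorem binaryForm_one_mul_one (a b : Fin 2 → R) :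
    binaryForm a * binaryForm b =
      binaryForm (n := 2) ![a 0 * b 0, a 0 * b 1 + a 1 * b 0, a 1 * b 1] := by
  simp [binaryForm, Fin.sum_univ_succ]
  ring

theorem binaryForm_one_mul_two (a : Fin 2 → R) (b : Fin 3 → R) :
    binaryForm a * binaryForm b = binaryForm (n := 3)
      ![a 0 * b 0, a 0 * b 1 + a 1 * b 0, a 0 * b 2 + a 1 * b 1, a 1 * b 2] := by
  simp [binaryForm, Fin.sum_univ_succ]
  ring

/-- The resultant of two binary linear forms. -/
def linearResultant (a b : Fin 2 → R) : R := a 0 * b 1 - a 1 * b 0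

/-- The resultant of two binary quadratic forms. -/
def quadraticResultant (a b : Fin 3 → R) : R :=
  (a 0 * b 2 - a 2 * b 0) ^ 2 - (a 0 * b 1 - a 1 * b 0) * (a 1 * b 2 - a 2 * b 1)

open scoped Matrix in
/-- The resultant of two binary cubic forms, in Bézout form. -/
def cubicResultant (a b : Fin 4 → R) : R :=
  let p : Fin 4 → Fin 4 → R := fun i j => a i * b j - a j * b i
  Matrix.det !![p 0 3, p 1 3, p 2 3; p 0 2, p 0 3 + p 1 2, p 1 3; p 0 1, p 0 2, p 0 3]

/-- The coefficients of the Jacobian of two binary cubic forms. -/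
def cubicJacobian (a b : Fin 4 → R) : Fin 5 → R :=
  let p : Fin 4 → Fin 4 → R := fun i j => a i * b j - a j * b i
  ![3 * p 0 1, 6 * p 0 2, 9 * p 0 3 + 3 * p 1 2, 6 * p 1 3, 3 * p 2 3]

/-- The coefficients of `(J, J)^(2) - 6 J (f, g)^(3)`, where `J` is the Jacobian of the binary
cubic forms `f`, `g` with coefficients `a`, `b`. -/
def cubicSecondCovariant (a b : Fin 4 → R) : Fin 5 → R :=
  let p : Fin 4 → Fin 4 → R := fun i j => a i * b j - a j * b i
  let r := cubicJacobian a b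
  ![2 * (24 * r 0 * r 2 - 9 * r 1 ^ 2), 2 * (72 * r 0 * r 3 - 12 * r 1 * r 2),
    2 * (144 * r 0 * r 4 + 18 * r 1 * r 3 - 12 * r 2 ^ 2),
    2 * (72 * r 1 * r 4 - 12 * r 2 * r 3), 2 * (24 * r 2 * r 4 - 9 * r 3 ^ 2)] -
  (6 * (36 * p 0 3 - 12 * p 1 2)) • r

theorem comp_cubicJacobian {S : Type*} [CommRing S] (φ : R →+* S) (a b : Fin 4 → R) :
    φ ∘ cubicJacobian a b = cubicJacobian (φ ∘ a) (φ ∘ b) := by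
  funext i
  fin_cases i <;> simp [cubicJacobian, map_ofNat]

theorem comp_cubicSecondCovariant {S : Type*} [CommRing S] (φ : R →+* S) (a b : Fin 4 → R) :
    φ ∘ cubicSecondCovariant a b = cubicSecondCovariant (φ ∘ a) (φ ∘ b) := by
  funext i
  fin_cases i <;>
    simp [cubicSecondCovariant, ← comp_cubicJacobian, Matrix.vecHead, Matrix.vecTail, map_ofNat]

theorem map_cubicResultant {S : Type*} [CommRing S] (φ : R →+* S) (a b : Fin 4 → R) :
    φ (cubicResultant a b) = cubicResultant (φ ∘ a) (φ ∘ b) := by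
  simp [cubicResultant, Matrix.det_fin_three]

theorem cubicSecondCovariant_eq_zero {a b : Fin 4 → R} (h : cubicJacobian a b = 0) :
    cubicSecondCovariant a b = 0 := by
  funext i
  fin_cases i <;> simp [cubicSecondCovariant, h]

theorem binaryForm_cubicSecondCovariant_of_linear_mul (l : Fin 2 → R) (q r : Fin 3 → R)
    {a b : Fin 4 → R} (ha : binaryForm a = binaryForm l * binaryForm q)
    (hb : binaryForm b = binaryForm l * binaryForm r) :
    binaryForm (cubicSecondCovariant a b) =
      C (-648 * quadraticResultant q r) * binaryForm l ^ 4 := by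
  rw [binaryForm_one_mul_two] at ha hb
  obtain rfl := binaryForm_injective ha
  obtain rfl := binaryForm_injective hb
  simp only [cubicSecondCovariant, cubicJacobian, quadraticResultant]
  simp [binaryForm, Fin.sum_univ_succ, map_ofNat]
  ring

theorem binaryForm_cubicJacobian_of_mul (l m k k' : Fin 2 → R) {a b : Fin 4 → R}
    (ha : binaryForm a = binaryForm l * (binaryForm m * binaryForm k))
    (hb : binaryForm b = binaryForm l * (binaryForm m * binaryForm k')) :
    binaryForm (cubicJacobian a b) =
      C (3 * linearResultant k k') * (binaryForm l * binaryForm m) ^ 2 := by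
  rw [binaryForm_one_mul_one, binaryForm_one_mul_two] at ha hb
  obtain rfl := binaryForm_injective ha
  obtain rfl := binaryForm_injective hb
  simp only [cubicJacobian, linearResultant]
  simp [binaryForm, Fin.sum_univ_succ, map_ofNat]
  ring

theorem cubicResultant_eq_zero_of_linear_mul (l : Fin 2 → R) (q r : Fin 3 → R)
    {a b : Fin 4 → R} (ha : binaryForm a = binaryForm l * binaryForm q)
    (hb : binaryForm b = binaryForm l * binaryForm r) : cubicResultant a b = 0 := by
  rw [binaryForm_one_mul_two] at ha hb
  obtain rfl := binaryForm_injective ha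
  obtain rfl := binaryForm_injective hb
  simp [cubicResultant, Matrix.det_fin_three]
  ring

theorem cubicSecondCovariant_eq_zero_of_quadratic_mul (q : Fin 3 → R) (k k' : Fin 2 → R)
    {a b : Fin 4 → R} (ha : binaryForm a = binaryForm k * binaryForm q)
    (hb : binaryForm b = binaryForm k' * binaryForm q) : cubicSecondCovariant a b = 0 := by
  rw [binaryForm_one_mul_two] at ha hb
  obtain rfl := binaryForm_injective ha
  obtain rfl := binaryForm_injective hb
  funext i
  simp only [cubicSecondCovariant, cubicJacobian]
  fin_cases i <;> simp <;> ring

theorem linearResultant_eq_eval (k m : Fin 2 → R) :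
    linearResultant k m = -eval ![k 1, -k 0] (binaryForm m) := by
  simp [linearResultant, binaryForm, Fin.sum_univ_succ]
  ring

theorem quadraticResultant_eq_eval (k l : Fin 2 → R) (b : Fin 3 → R)
    {a : Fin 3 → R} (ha : binaryForm a = binaryForm k * binaryForm l) :
    quadraticResultant a b =
      eval ![k 1, -k 0] (binaryForm b) * eval ![l 1, -l 0] (binaryForm b) := by
  rw [binaryForm_one_mul_one] at ha
  obtain rfl := binaryForm_injective ha
  simp [quadraticResultant, binaryForm, Fin.sum_univ_succ]
  ring

theorem cubicResultant_eq_eval (k l m : Fin 2 → R) (b : Fin 4 → R) {a : Fin 4 → R}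
    (ha : binaryForm a = binaryForm k * (binaryForm l * binaryForm m)) :
    cubicResultant a b = -(eval ![k 1, -k 0] (binaryForm b) *
      (eval ![l 1, -l 0] (binaryForm b) * eval ![m 1, -m 0] (binaryForm b))) := by
  rw [binaryForm_one_mul_one, binaryForm_one_mul_two] at ha
  obtain rfl := binaryForm_injective ha
  simp [cubicResultant, Matrix.det_fin_three, binaryForm, Fin.sum_univ_succ]
  ring

end BinaryForm

section Transvectant

variable {R : Type*} [CommRing R]

theorem pderiv_zero_binaryForm {n : ℕ} (a : Fin (n + 2) → R) :
    pderiv 0 (binaryForm a) =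
      binaryForm fun i : Fin (n + 1) => ((n + 1 - (i : ℕ) : ℕ) : R) * a i.castSucc := by
  simp only [binaryForm, map_sum]
  rw [Fin.sum_univ_castSucc]
  have hlast : pderiv (0 : Fin 2) (C (a (Fin.last (n + 1))) *
      X 0 ^ (n + 1 - ((Fin.last (n + 1) : Fin (n + 2)) : ℕ)) *
      X 1 ^ ((Fin.last (n + 1) : Fin (n + 2)) : ℕ)) = 0 := by
    simp
  rw [hlast, add_zero]
  refine Finset.sum_congr rfl fun i _ => ?_
  have h : n + 1 - (i : ℕ) - 1 = n - i := by omega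
  simp [h]
  ring

theorem pderiv_one_binaryForm {n : ℕ} (a : Fin (n + 2) → R) :
    pderiv 1 (binaryForm a) =
      binaryForm fun i : Fin (n + 1) => (((i : ℕ) + 1 : ℕ) : R) * a i.succ := by
  simp only [binaryForm, map_sum]
  rw [Fin.sum_univ_succ]
  have hzero : pderiv (1 : Fin 2) (C (a 0) * X 0 ^ (n + 1 - ((0 : Fin (n + 2)) : ℕ)) *
      X 1 ^ ((0 : Fin (n + 2)) : ℕ)) = 0 := by
    simp
  rw [hzero, zero_add]
  refine Finset.sum_congr rfl fun i _ => ?_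
  simp
  ring

theorem transvectant_one_binaryForm (a b : Fin 4 → ℝ) :
    transvectant 1 (binaryForm a) (binaryForm b) = binaryForm (cubicJacobian a b) := by
  simp [transvectant, Finset.sum_range_succ, pderiv_zero_binaryForm, pderiv_one_binaryForm]
  simp only [cubicJacobian]
  simp [binaryForm, Fin.sum_univ_succ, map_ofNat]
  ring

theorem transvectant_three_binaryForm (a b : Fin 4 → ℝ) :
    transvectant 3 (binaryForm a) (binaryForm b) =
      C (36 * (a 0 * b 3 - a 3 * b 0) - 12 * (a 1 * b 2 - a 2 * b 1)) := by
  simp [transvectant, Finset.sum_range_succ, pderiv_zero_binaryForm, pderiv_one_binaryForm]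
  simp [binaryForm, smul_eq_C_mul, map_ofNat]
  norm_num [Nat.choose]
  ring

theorem transvectant_two_binaryForm (r : Fin 5 → ℝ) :
    transvectant 2 (binaryForm r) (binaryForm r) = binaryForm (n := 4)
      ![2 * (24 * r 0 * r 2 - 9 * r 1 ^ 2), 2 * (72 * r 0 * r 3 - 12 * r 1 * r 2),
        2 * (144 * r 0 * r 4 + 18 * r 1 * r 3 - 12 * r 2 ^ 2),
        2 * (72 * r 1 * r 4 - 12 * r 2 * r 3), 2 * (24 * r 2 * r 4 - 9 * r 3 ^ 2)] := by
  simp [transvectant, Finset.sum_range_succ, pderiv_zero_binaryForm, pderiv_one_binaryForm]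
  simp [binaryForm, Fin.sum_univ_succ, smul_eq_C_mul, map_ofNat]
  norm_num [Nat.choose]
  ring

theorem transvectant_four_binaryForm (s r : Fin 5 → ℝ) :
    transvectant 4 (binaryForm s) (binaryForm r) =
      C (576 * (s 0 * r 4 + s 4 * r 0) - 144 * (s 1 * r 3 + s 3 * r 1) + 96 * (s 2 * r 2)) := by
  simp [transvectant, Finset.sum_range_succ, pderiv_zero_binaryForm, pderiv_one_binaryForm]
  simp [binaryForm, smul_eq_C_mul, map_ofNat]
  norm_num [Nat.choose]
  ring

theorem transvectant_two_jacobian_sub (a b : Fin 4 → ℝ) :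
    transvectant 2 (binaryForm (cubicJacobian a b)) (binaryForm (cubicJacobian a b)) -
        6 • (binaryForm (cubicJacobian a b) * transvectant 3 (binaryForm a) (binaryForm b)) =
      binaryForm (cubicSecondCovariant a b) := by
  rw [transvectant_two_binaryForm, transvectant_three_binaryForm]
  simp only [cubicSecondCovariant]
  simp [binaryForm, Fin.sum_univ_succ, map_ofNat]
  ring

theorem smul_transvectant_four_secondCovariant_jacobian (a b : Fin 4 → ℝ) :
    (-(2 ^ 9 * 3 ^ 8 : ℝ)⁻¹) • transvectant 4 (binaryForm (cubicSecondCovariant a b))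
      (binaryForm (cubicJacobian a b)) = C (cubicResultant a b) := by
  rw [transvectant_four_binaryForm, smul_eq_C_mul, ← C_mul]
  congr 1
  simp [cubicSecondCovariant, cubicJacobian, cubicResultant, Matrix.det_fin_three]
  ring

end Transvectant

section Factorization

theorem homogeneousComponent_add_mul {σ R : Type*} [CommSemiring R] {f g : MvPolynomial σ R}
    {m n : ℕ} (hf : f.totalDegree ≤ m) (hg : g.totalDegree ≤ n) :
    homogeneousComponent (m + n) (f * g) =
      homogeneousComponent m f * homogeneousComponent n g := by
  have expand : ∀ (p : MvPolynomial σ R) (k : ℕ), p.totalDegree ≤ k →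
      p = ∑ i ∈ Finset.range (k + 1), homogeneousComponent i p := by
    intro p k hk
    conv_lhs => rw [← sum_homogeneousComponent p]
    refine Finset.sum_subset (Finset.range_mono (by omega)) fun i _ hi => ?_
    exact homogeneousComponent_eq_zero _ _ (by simpa [Nat.lt_succ_iff] using hi)
  conv_lhs => rw [expand f m hf, expand g n hg, Finset.sum_mul_sum, map_sum]
  simp only [map_sum]
  have term : ∀ i j, homogeneousComponent (m + n)
      (homogeneousComponent i f * homogeneousComponent j g) =
      if i + j = m + n then homogeneousComponent i f * homogeneousComponent j g else 0 := by
    intro i j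
    rw [homogeneousComponent_of_mem ((mem_homogeneousSubmodule _ _).2
      ((homogeneousComponent_isHomogeneous i f).mul (homogeneousComponent_isHomogeneous j g)))]
    simp only [eq_comm]
  simp only [term]
  rw [Finset.sum_eq_single m, Finset.sum_eq_single n]
  · simp
  · intro j _ hj
    exact if_neg (by omega)
  · simp
  · intro i hi him
    refine Finset.sum_eq_zero fun j hj => if_neg ?_
    simp only [Finset.mem_range] at hi hj
    omega
  · simp

/-- The leading form of a divisor of a homogeneous polynomial is again a divisor, with a
homogeneous cofactor. -/
theorem IsHomogeneous.exists_eq_homogeneousComponent_mul {σ R : Type*} [CommRing R] [IsDomain R]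
    {f h : MvPolynomial σ R} {m n : ℕ} (hf : f.IsHomogeneous (m + n))
    (hdeg : h.totalDegree = m) (hdvd : h ∣ f) :
    ∃ k : MvPolynomial σ R, k.IsHomogeneous n ∧ f = homogeneousComponent m h * k := by
  rcases eq_or_ne f 0 with rfl | hf0
  · exact ⟨0, isHomogeneous_zero _ _ _, by simp⟩
  obtain ⟨k, rfl⟩ := hdvd
  have hh := left_ne_zero_of_mul hf0
  have hk := right_ne_zero_of_mul hf0
  have hkn : k.totalDegree = n := by
    have := hf.totalDegree hf0
    rw [totalDegree_mul_of_isDomain hh hk] at this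
    omega
  refine ⟨homogeneousComponent n k, homogeneousComponent_isHomogeneous n k, ?_⟩
  rw [← homogeneousComponent_add_mul hdeg.le hkn.le, homogeneousComponent_eq_self hf]

theorem IsHomogeneous.exists_eq_mul_of_dvd {σ R : Type*} [CommRing R] [IsDomain R]
    {f h : MvPolynomial σ R} {m n : ℕ} (hf : f.IsHomogeneous (m + n)) (hh : h.IsHomogeneous m)
    (hh0 : h ≠ 0) (hdvd : h ∣ f) : ∃ k : MvPolynomial σ R, k.IsHomogeneous n ∧ f = h * k := by
  obtain ⟨k, hk, h_eq⟩ := hf.exists_eq_homogeneousComponent_mul (hh.totalDegree hh0) hdvd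
  exact ⟨k, hk, by rwa [homogeneousComponent_eq_self hh] at h_eq⟩

variable {K : Type*} [Field K] [IsAlgClosed K]

theorem IsHomogeneous.exists_linear_factor {n : ℕ} {f : MvPolynomial (Fin 2) K}
    (hf : f.IsHomogeneous (n + 1)) :
    ∃ l : Fin 2 → K, l ≠ 0 ∧ ∃ k, k.IsHomogeneous n ∧ f = binaryForm l * k := by
  obtain ⟨p, hp, rfl⟩ : ∃ p : Polynomial K, p.natDegree ≤ n + 1 ∧ f = p.homogenize (n + 1) := by
    obtain ⟨a, rfl⟩ := hf.exists_eq_binaryForm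
    refine ⟨MvPolynomial.aeval ![Polynomial.X, 1] (binaryForm a), ?_,
      (Polynomial.homogenize_eq_of_isHomogeneous hf rfl).symm⟩
    simp only [binaryForm, map_sum]
    refine Polynomial.natDegree_sum_le_of_forall_le _ _ fun i _ => ?_
    simpa using (Polynomial.natDegree_C_mul_X_pow_le (a i) (n + 1 - i)).trans (Nat.sub_le _ _)
  rcases hp.lt_or_eq with hlt | heq
  · refine ⟨![0, 1], by simp, p.homogenize n, Polynomial.isHomogeneous_homogenize p, ?_⟩
    have := Polynomial.homogenize_mul p 1 (m := n) (n := 1) (by omega) (by simp)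
    rw [mul_one] at this
    rw [this, mul_comm]
    simp [binaryForm]
  · obtain ⟨t, ht⟩ := IsAlgClosed.exists_root p (by
      intro h
      rw [Polynomial.degree_eq_natDegree (by rintro rfl; simp at heq), heq] at h
      norm_cast at h)
    obtain ⟨q, rfl⟩ := Polynomial.dvd_iff_isRoot.2 ht
    have hq : q.natDegree ≤ n := by
      rw [Polynomial.natDegree_mul (Polynomial.X_sub_C_ne_zero t)
        (by rintro rfl; simp at heq), Polynomial.natDegree_X_sub_C] at heq
      omega
    refine ⟨![1, -t], by simp, q.homogenize n, Polynomial.isHomogeneous_homogenize q, ?_⟩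
    rw [add_comm n 1, Polynomial.homogenize_mul _ _ (by simp) hq]
    simp [binaryForm, sub_eq_add_neg]

theorem linear_dvd_of_linearResultant_eq_zero {F : Type*} [Field F] {l m : Fin 2 → F}
    (hm : m ≠ 0) (h : linearResultant l m = 0) : binaryForm m ∣ binaryForm l := by
  have h' : l 0 * m 1 = l 1 * m 0 := sub_eq_zero.mp h
  by_cases h0 : m 0 = 0
  · have h1 : m 1 ≠ 0 := fun h1 => hm (by funext i; fin_cases i <;> assumption)
    have hl : l 0 = 0 := by simpa [h0, h1] using h'
    refine ⟨C (l 1 / m 1), ?_⟩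
    have : C (m 1) * C (l 1 / m 1) = (C (l 1) : MvPolynomial (Fin 2) F) := by
      rw [← C_mul, mul_div_cancel₀ _ h1]
    simp [binaryForm, Fin.sum_univ_succ, h0, hl]
    linear_combination -this * X 1
  · refine ⟨C (l 0 / m 0), ?_⟩
    have e0 : C (m 0) * C (l 0 / m 0) = (C (l 0) : MvPolynomial (Fin 2) F) := by
      rw [← C_mul, mul_div_cancel₀ _ h0]
    have e1 : C (m 1) * C (l 0 / m 0) = (C (l 1) : MvPolynomial (Fin 2) F) := by
      rw [← C_mul]
      congr 1
      field_simp
      linear_combination h'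
    simp [binaryForm, Fin.sum_univ_succ]
    linear_combination -e0 * X 0 - e1 * X 1

theorem IsHomogeneous.linear_dvd_of_eval_eq_zero {n : ℕ} {f : MvPolynomial (Fin 2) K}
    (hf : f.IsHomogeneous n) {l : Fin 2 → K} (hl : l ≠ 0)
    (h : eval ![l 1, -l 0] f = 0) : binaryForm l ∣ f := by
  induction n generalizing f with
  | zero =>
    rw [totalDegree_eq_zero_iff_eq_C.1 (Nat.le_zero.1 hf.totalDegree_le)] at h ⊢
    rw [eval_C] at h
    simp [h]
  | succ n ih =>
    obtain ⟨m, hm, k, hk, rfl⟩ := hf.exists_linear_factor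
    rw [map_mul, mul_eq_zero] at h
    rcases h with h | h
    · refine Dvd.dvd.mul_right (linear_dvd_of_linearResultant_eq_zero hl ?_) k
      simp [linearResultant, binaryForm, Fin.sum_univ_succ] at h ⊢
      linear_combination h
    · exact (ih hk h).mul_left _

/-- The forms `f` and `g` of degree `n + 1` have a common linear factor. -/
def HasCommonLinearFactor (n : ℕ) (f g : MvPolynomial (Fin 2) K) : Prop :=
  ∃ l : Fin 2 → K, l ≠ 0 ∧ ∃ a b : Fin (n + 1) → K,
    f = binaryForm l * binaryForm a ∧ g = binaryForm l * binaryForm b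

theorem HasCommonLinearFactor.of_dvd {F : Type*} [Field F] {n : ℕ} {f g : MvPolynomial (Fin 2) F}
    (hf : f.IsHomogeneous (n + 1)) (hg : g.IsHomogeneous (n + 1)) {l : Fin 2 → F} (hl : l ≠ 0)
    (hlf : binaryForm l ∣ f) (hlg : binaryForm l ∣ g) : HasCommonLinearFactor n f g := by
  have hl0 : binaryForm l ≠ 0 := binaryForm_eq_zero_iff.not.2 hl
  rw [add_comm] at hf hg
  obtain ⟨p, hp, hfp⟩ := hf.exists_eq_mul_of_dvd (isHomogeneous_binaryForm l) hl0 hlf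
  obtain ⟨q, hq, hgq⟩ := hg.exists_eq_mul_of_dvd (isHomogeneous_binaryForm l) hl0 hlg
  obtain ⟨a, rfl⟩ := hp.exists_eq_binaryForm
  obtain ⟨b, rfl⟩ := hq.exists_eq_binaryForm
  exact ⟨l, hl, a, b, hfp, hgq⟩

/-- If the first form has a linear factor whose root is a root of the second one, the two forms have
a common linear factor. -/
theorem HasCommonLinearFactor.of_eval {n : ℕ} {f g : MvPolynomial (Fin 2) K}
    (hf : f.IsHomogeneous (n + 1)) (hg : g.IsHomogeneous (n + 1)) {l : Fin 2 → K} (hl : l ≠ 0)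
    (hlf : binaryForm l ∣ f) (h : eval ![l 1, -l 0] g = 0) : HasCommonLinearFactor n f g :=
  .of_dvd hf hg hl hlf (hg.linear_dvd_of_eval_eq_zero hl h)

theorem HasCommonLinearFactor.zero_left {n : ℕ} {g : MvPolynomial (Fin 2) K}
    (hg : g.IsHomogeneous (n + 1)) : HasCommonLinearFactor n 0 g := by
  obtain ⟨l, hl, k, -, rfl⟩ := hg.exists_linear_factor
  exact .of_dvd (isHomogeneous_zero _ _ _) hg hl (dvd_zero _) (dvd_mul_right _ _)

theorem hasCommonLinearFactor_of_linearResultant_eq_zero {a b : Fin 2 → K}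
    (h : linearResultant a b = 0) : HasCommonLinearFactor 0 (binaryForm a) (binaryForm b) := by
  have hb := isHomogeneous_binaryForm b
  rcases eq_or_ne (binaryForm a) 0 with ha0 | ha0
  · rw [ha0]
    exact .zero_left hb
  · rw [linearResultant_eq_eval, neg_eq_zero] at h
    exact .of_eval (isHomogeneous_binaryForm a) hb (binaryForm_eq_zero_iff.not.1 ha0) dvd_rfl h

theorem exists_binaryForm_two_eq_mul {a : Fin 3 → K} (ha : a ≠ 0) :
    ∃ k l : Fin 2 → K, k ≠ 0 ∧ l ≠ 0 ∧ binaryForm a = binaryForm k * binaryForm l := by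
  obtain ⟨k, hk, p, hp, hap⟩ := (isHomogeneous_binaryForm a).exists_linear_factor
  obtain ⟨l, rfl⟩ := hp.exists_eq_binaryForm
  refine ⟨k, l, hk, ?_, hap⟩
  rintro rfl
  rw [binaryForm_eq_zero_iff.2 rfl, mul_zero] at hap
  exact ha (binaryForm_eq_zero_iff.1 hap)

theorem exists_binaryForm_three_eq_mul {a : Fin 4 → K} (ha : a ≠ 0) :
    ∃ k l m : Fin 2 → K, k ≠ 0 ∧ l ≠ 0 ∧ m ≠ 0 ∧
      binaryForm a = binaryForm k * (binaryForm l * binaryForm m) := by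
  obtain ⟨k, hk, p, hp, hap⟩ := (isHomogeneous_binaryForm a).exists_linear_factor
  obtain ⟨q, rfl⟩ := hp.exists_eq_binaryForm
  have hq : q ≠ 0 := by
    rintro rfl
    rw [binaryForm_eq_zero_iff.2 rfl, mul_zero] at hap
    exact ha (binaryForm_eq_zero_iff.1 hap)
  obtain ⟨l, m, hl, hm, hqlm⟩ := exists_binaryForm_two_eq_mul hq
  exact ⟨k, l, m, hk, hl, hm, by rw [hap, hqlm]⟩

theorem hasCommonLinearFactor_of_quadraticResultant_eq_zero {a b : Fin 3 → K}
    (h : quadraticResultant a b = 0) :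
    HasCommonLinearFactor 1 (binaryForm a) (binaryForm b) := by
  have ha := isHomogeneous_binaryForm a
  have hb := isHomogeneous_binaryForm b
  rcases eq_or_ne a 0 with ha0 | ha0
  · rw [binaryForm_eq_zero_iff.2 ha0]
    exact .zero_left hb
  obtain ⟨k, l, hk, hl, hkl⟩ := exists_binaryForm_two_eq_mul ha0
  rw [quadraticResultant_eq_eval k l b hkl, mul_eq_zero] at h
  rcases h with h | h
  · exact .of_eval ha hb hk (Dvd.intro _ hkl.symm) h
  · exact .of_eval ha hb hl (Dvd.intro_left _ hkl.symm) h

theorem hasCommonLinearFactor_of_cubicResultant_eq_zero {a b : Fin 4 → K}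
    (h : cubicResultant a b = 0) :
    HasCommonLinearFactor 2 (binaryForm a) (binaryForm b) := by
  have ha := isHomogeneous_binaryForm a
  have hb := isHomogeneous_binaryForm b
  rcases eq_or_ne a 0 with ha0 | ha0
  · rw [binaryForm_eq_zero_iff.2 ha0]
    exact .zero_left hb
  obtain ⟨k, l, m, hk, hl, hm, hklm⟩ := exists_binaryForm_three_eq_mul ha0
  rw [cubicResultant_eq_eval k l m b hklm, neg_eq_zero, mul_eq_zero, mul_eq_zero] at h
  rcases h with h | h | h
  · exact .of_eval ha hb hk (Dvd.intro _ hklm.symm) h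
  · exact .of_eval ha hb hl (by rw [hklm]; exact (dvd_mul_right _ _).mul_left _) h
  · exact .of_eval ha hb hm (by rw [hklm]; exact (dvd_mul_left _ _).mul_left _) h

variable [CharZero K]

theorem exists_common_quadratic_factor {a b : Fin 4 → K} (hres : cubicResultant a b = 0)
    (hcov : cubicSecondCovariant a b = 0) :
    ∃ l m : Fin 2 → K, l ≠ 0 ∧ m ≠ 0 ∧ ∃ k k' : Fin 2 → K,
      binaryForm a = binaryForm l * (binaryForm m * binaryForm k) ∧
      binaryForm b = binaryForm l * (binaryForm m * binaryForm k') := by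
  obtain ⟨l, hl, q, r, ha, hb⟩ := hasCommonLinearFactor_of_cubicResultant_eq_zero hres
  have key := binaryForm_cubicSecondCovariant_of_linear_mul l q r ha hb
  rw [binaryForm_eq_zero_iff.2 hcov, eq_comm, mul_eq_zero,
    or_iff_left (pow_ne_zero _ (binaryForm_eq_zero_iff.not.2 hl)), C_eq_zero, mul_eq_zero,
    or_iff_right (by norm_num)] at key
  obtain ⟨m, hm, k, k', hq, hr⟩ := hasCommonLinearFactor_of_quadraticResultant_eq_zero key
  exact ⟨l, m, hl, hm, k, k', by rw [ha, hq], by rw [hb, hr]⟩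

theorem exists_common_cubic_factor {a b : Fin 4 → K} (hres : cubicResultant a b = 0)
    (hjac : cubicJacobian a b = 0) :
    ∃ l m n : Fin 2 → K, l ≠ 0 ∧ m ≠ 0 ∧ n ≠ 0 ∧
      binaryForm l * (binaryForm m * binaryForm n) ∣ binaryForm a ∧
      binaryForm l * (binaryForm m * binaryForm n) ∣ binaryForm b := by
  obtain ⟨l, m, hl, hm, k, k', ha, hb⟩ :=
    exists_common_quadratic_factor hres (cubicSecondCovariant_eq_zero hjac)
  have key := binaryForm_cubicJacobian_of_mul l m k k' ha hb
  rw [binaryForm_eq_zero_iff.2 hjac, eq_comm, mul_eq_zero,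
    or_iff_left (pow_ne_zero _ (mul_ne_zero (binaryForm_eq_zero_iff.not.2 hl)
      (binaryForm_eq_zero_iff.not.2 hm))), C_eq_zero, mul_eq_zero,
    or_iff_right (by norm_num)] at key
  obtain ⟨n, hn, c, c', hk, hk'⟩ := hasCommonLinearFactor_of_linearResultant_eq_zero key
  refine ⟨l, m, n, hl, hm, hn, ?_, ?_⟩
  · rw [ha, hk]
    exact mul_dvd_mul_left _ (mul_dvd_mul_left _ (dvd_mul_right _ _))
  · rw [hb, hk']
    exact mul_dvd_mul_left _ (mul_dvd_mul_left _ (dvd_mul_right _ _))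

end Factorization

section CommonDivisor

theorem exists_eq_binaryForm_mul_of_dvd {R : Type*} [CommRing R] [IsDomain R] {m n : ℕ}
    {f g h : MvPolynomial (Fin 2) R} (hf : f.IsHomogeneous (m + n)) (hg : g.IsHomogeneous (m + n))
    (hdeg : h.totalDegree = m) (hhf : h ∣ f) (hhg : h ∣ g) :
    ∃ (e : Fin (m + 1) → R) (k k' : Fin (n + 1) → R),
      f = binaryForm e * binaryForm k ∧ g = binaryForm e * binaryForm k' := by
  obtain ⟨p, hp, hfp⟩ := hf.exists_eq_homogeneousComponent_mul hdeg hhf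
  obtain ⟨q, hq, hgq⟩ := hg.exists_eq_homogeneousComponent_mul hdeg hhg
  obtain ⟨e, he⟩ := (homogeneousComponent_isHomogeneous m h).exists_eq_binaryForm
  obtain ⟨k, rfl⟩ := hp.exists_eq_binaryForm
  obtain ⟨k', rfl⟩ := hq.exists_eq_binaryForm
  exact ⟨e, k, k', by rw [hfp, he], by rw [hgq, he]⟩

theorem cubicJacobian_eq_zero_of_cubic_mul {R : Type*} [CommRing R] {a b e : Fin 4 → R}
    {k k' : Fin 1 → R} (ha : binaryForm a = binaryForm e * binaryForm k)
    (hb : binaryForm b = binaryForm e * binaryForm k') : cubicJacobian a b = 0 := by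
  have hmul : ∀ c : Fin 1 → R, binaryForm e * binaryForm c = binaryForm fun i => e i * c 0 := by
    intro c
    simp [binaryForm, Fin.sum_univ_succ]
    ring
  rw [hmul] at ha hb
  obtain rfl := binaryForm_injective ha
  obtain rfl := binaryForm_injective hb
  funext i
  fin_cases i <;> simp [cubicJacobian] <;> ring

theorem cubicResultant_eq_zero_of_cubicSecondCovariant_eq_zero {a b : Fin 4 → ℝ}
    (h : cubicSecondCovariant a b = 0) : cubicResultant a b = 0 := by
  have key := smul_transvectant_four_secondCovariant_jacobian a b
  rw [h, transvectant_four_binaryForm] at key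
  simpa using key.symm

theorem comp_algebraMap_eq_zero_iff {n : ℕ} {a : Fin n → ℝ} : algebraMap ℝ ℂ ∘ a = 0 ↔ a = 0 := by
  rw [_root_.funext_iff, _root_.funext_iff]
  exact forall_congr' fun i => map_eq_zero (algebraMap ℝ ℂ)

end CommonDivisor

end MvPolynomial

/-- For real binary cubic forms `C₂, D` with `d̃ = deg gcd(C₂, D)` over ℂ, and
`B₃ = Jacobian(C₂,D) = (C₂,D)^{(1)}`, `B₂ = (B₃,B₃)^{(2)} − 6·B₃·(C₂,D)^{(3)}`,
`B₁ = −2⁻⁹·3⁻⁸·(B₂,B₃)^{(4)}`: `d̃ = 0 ↔ B₁ ≠ 0`; `d̃ = 1 ↔ B₁ = 0 ∧ B₂ ≠ 0`;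
`d̃ = 2 ↔ B₂ = 0 ∧ B₃ ≠ 0`; `d̃ = 3 ↔ B₃ = 0`. -/
theorem gcd_degree_cubic_forms
    (C2 D : MvPolynomial (Fin 2) ℝ)
    (hC : C2.IsHomogeneous 3) (hD : D.IsHomogeneous 3)
    (d : ℕ)
    (hd : ∃ h : MvPolynomial (Fin 2) ℂ,
      h ∣ map (algebraMap ℝ ℂ) C2 ∧ h ∣ map (algebraMap ℝ ℂ) D ∧ h.totalDegree = d ∧
      ∀ h' : MvPolynomial (Fin 2) ℂ,
        h' ∣ map (algebraMap ℝ ℂ) C2 → h' ∣ map (algebraMap ℝ ℂ) D →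
          h'.totalDegree ≤ d) :
    let B3 := transvectant 1 C2 D
    let B2 := transvectant 2 B3 B3 - 6 • (B3 * transvectant 3 C2 D)
    let B1 := (-(2 ^ 9 * 3 ^ 8 : ℝ)⁻¹) • transvectant 4 B2 B3
    (d = 0 ↔ B1 ≠ 0) ∧
    (d = 1 ↔ (B1 = 0 ∧ B2 ≠ 0)) ∧
    (d = 2 ↔ (B2 = 0 ∧ B3 ≠ 0)) ∧
    (d = 3 ↔ B3 = 0) := by
  intro B3 B2 B1
  obtain ⟨h, hhC, hhD, hdeg, hmax⟩ := hd
  obtain ⟨a, rfl⟩ := hC.exists_eq_binaryForm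
  obtain ⟨b, rfl⟩ := hD.exists_eq_binaryForm
  have hB3 : B3 = binaryForm (cubicJacobian a b) := transvectant_one_binaryForm a b
  have hB2 : B2 = binaryForm (cubicSecondCovariant a b) := by
    simp only [B2, hB3, transvectant_two_jacobian_sub]
  have hB1 : B1 = C (cubicResultant a b) := by
    simp only [B1, hB2, hB3, smul_transvectant_four_secondCovariant_jacobian]
  rw [ne_eq, ne_eq, ne_eq, hB1, hB2, hB3, C_eq_zero, binaryForm_eq_zero_iff, binaryForm_eq_zero_iff]
  clear_value B3 B2 B1
  rw [map_binaryForm] at hhC hhD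
  simp only [map_binaryForm] at hmax
  have hjac := comp_algebraMap_eq_zero_iff (a := cubicJacobian a b)
  have hcov := comp_algebraMap_eq_zero_iff (a := cubicSecondCovariant a b)
  have hres := map_eq_zero (algebraMap ℝ ℂ) (a := cubicResultant a b)
  rw [comp_cubicJacobian] at hjac
  rw [comp_cubicSecondCovariant] at hcov
  rw [map_cubicResultant] at hres
  generalize algebraMap ℝ ℂ ∘ a = α at *
  generalize algebraMap ℝ ℂ ∘ b = β at *
  have hα := isHomogeneous_binaryForm α
  have hβ := isHomogeneous_binaryForm β
  have hcov_of_jac : cubicJacobian a b = 0 → cubicSecondCovariant a b = 0 :=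
    cubicSecondCovariant_eq_zero
  have hres_of_cov : cubicSecondCovariant a b = 0 → cubicResultant a b = 0 :=
    cubicResultant_eq_zero_of_cubicSecondCovariant_eq_zero
  have hd3 : d ≤ 3 := by
    by_contra! hlt
    have key : ∀ f : MvPolynomial (Fin 2) ℂ, f.IsHomogeneous 3 → h ∣ f → f = 0 := by
      intro f hf hhf
      by_contra hf0
      have := totalDegree_le_of_dvd_of_isDomain hhf hf0
      rw [hf.totalDegree hf0] at this
      omega
    rw [key _ hα hhC, key _ hβ hhD] at hmax
    have := hmax (X 0 ^ (d + 1)) (dvd_zero _) (dvd_zero _)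
    rw [totalDegree_X_pow] at this
    omega
  have one_le : cubicResultant a b = 0 → 1 ≤ d := by
    intro h0
    obtain ⟨l, hl, q, r, ha, hb⟩ := hasCommonLinearFactor_of_cubicResultant_eq_zero (hres.2 h0)
    rw [← (isHomogeneous_binaryForm l).totalDegree (binaryForm_eq_zero_iff.not.2 hl)]
    exact hmax _ (Dvd.intro _ ha.symm) (Dvd.intro _ hb.symm)
  have two_le : cubicSecondCovariant a b = 0 → 2 ≤ d := by
    intro h0
    obtain ⟨l, m, hl, hm, k, k', ha, hb⟩ :=
      exists_common_quadratic_factor (hres.2 (hres_of_cov h0)) (hcov.2 h0)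
    rw [← mul_assoc] at ha hb
    refine (((isHomogeneous_binaryForm l).mul (isHomogeneous_binaryForm m)).totalDegree
      (mul_ne_zero (binaryForm_eq_zero_iff.not.2 hl) (binaryForm_eq_zero_iff.not.2 hm))).ge.trans ?_
    exact hmax _ (Dvd.intro _ ha.symm) (Dvd.intro _ hb.symm)
  have three_le : cubicJacobian a b = 0 → 3 ≤ d := by
    intro h0
    obtain ⟨l, m, n, hl, hm, hn, ha, hb⟩ :=
      exists_common_cubic_factor (hres.2 (hres_of_cov (hcov_of_jac h0))) (hjac.2 h0)
    refine (((isHomogeneous_binaryForm l).mul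
      ((isHomogeneous_binaryForm m).mul (isHomogeneous_binaryForm n))).totalDegree
      (mul_ne_zero (binaryForm_eq_zero_iff.not.2 hl) (mul_ne_zero (binaryForm_eq_zero_iff.not.2 hm)
        (binaryForm_eq_zero_iff.not.2 hn)))).ge.trans ?_
    exact hmax _ ha hb
  have of_one : d = 1 → cubicResultant a b = 0 := by
    rintro rfl
    obtain ⟨l, q, r, ha, hb⟩ := exists_eq_binaryForm_mul_of_dvd (n := 2) hα hβ hdeg hhC hhD
    exact hres.1 (cubicResultant_eq_zero_of_linear_mul l q r ha hb)
  have of_two : d = 2 → cubicSecondCovariant a b = 0 := by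
    rintro rfl
    obtain ⟨q, k, k', ha, hb⟩ := exists_eq_binaryForm_mul_of_dvd (n := 1) hα hβ hdeg hhC hhD
    rw [mul_comm] at ha hb
    exact hcov.1 (cubicSecondCovariant_eq_zero_of_quadratic_mul q k k' ha hb)
  have of_three : d = 3 → cubicJacobian a b = 0 := by
    rintro rfl
    obtain ⟨e, k, k', ha, hb⟩ := exists_eq_binaryForm_mul_of_dvd (n := 0) hα hβ hdeg hhC hhD
    exact hjac.1 (cubicJacobian_eq_zero_of_cubic_mul ha hb)
  clear hmax hdeg hjac hcov hres
  interval_cases d <;> simp_all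
end

section
/- Let Φ_{u,v}(x,y) = u·p(x,y) + v·q(x,y) for a quadratic system with homogenized forms P, Q and define D(x,y) = 4Δ(−y, x) where Δ(α,β) is the determinant of the symmetric 3×3 matrix of the ternary conic αP + βQ. If the system has an invariant affine line ux + vy + w = 0 then D(−v, u) = 0 and C₂(−v, u) = 0, where C₂(x,y) = y·p₂(x,y) − x·q₂(x,y); consequently if the system has invariant lines in m ≤ 3 distinct directions, then the cubic binary forms C₂ and D have at least m distinct common linear factors over ℂ. -/
open MvPolynomial

theorem MvPolynomial.IsHomogeneous.aeval_mul_left {R S σ : Type*} [CommSemiring R]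
    [CommSemiring S] [Algebra R S] {φ : MvPolynomial σ R} {n : ℕ} (hφ : φ.IsHomogeneous n)
    (c : S) (g : σ → S) :
    MvPolynomial.aeval (fun i => c * g i) φ = c ^ n * MvPolynomial.aeval g φ := by
  rw [aeval_def, aeval_def, eval₂_eq, eval₂_eq, Finset.mul_sum]
  refine Finset.sum_congr rfl fun d hd => ?_
  simp only [mul_pow, Finset.prod_mul_distrib, Finset.prod_pow_eq_pow_sum]
  rw [← hφ.degree_eq_sum_deg_support hd]
  ring

theorem MvPolynomial.IsHomogeneous.det {R σ ι : Type*} [CommRing R] [Fintype ι] [DecidableEq ι]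
    {M : Matrix ι ι (MvPolynomial σ R)} (hM : ∀ i j, (M i j).IsHomogeneous 1) :
    M.det.IsHomogeneous (Fintype.card ι) := by
  rw [Matrix.det_apply]
  refine IsHomogeneous.sum _ _ _ fun τ _ => ?_
  have h : (∏ i, M (τ i) i).IsHomogeneous (Fintype.card ι) := by
    simpa using IsHomogeneous.prod Finset.univ _ _ fun i _ => hM (τ i) i
  obtain hs | hs := Int.units_eq_one_or (Equiv.Perm.sign τ)
  · simpa [hs] using h
  · simpa [hs] using h.neg

/-- A binary form vanishing at `(-v, u)` is divisible by the linear form `u x + v y`. -/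
theorem MvPolynomial.IsHomogeneous.linear_dvd_of_eval_eq_zero_s19 {K : Type*} [Field K]
    {f : MvPolynomial (Fin 2) K} {n : ℕ} (hf : f.IsHomogeneous n) {u v : K}
    (huv : u ≠ 0 ∨ v ≠ 0) (h : eval ![-v, u] f = 0) :
    (C u * X 0 + C v * X 1) ∣ f := by
  let I : Ideal (MvPolynomial (Fin 2) K) := Ideal.span {C u * X 0 + C v * X 1}
  let π := Ideal.Quotient.mkₐ K I
  have hπ : π f = MvPolynomial.aeval (fun i => π (X i)) f := by
    rw [← comp_aeval_apply (f := X) π f, aeval_X_left_apply]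
  have hL : algebraMap K _ u * π (X 0) + algebraMap K _ v * π (X 1) = 0 := by
    have : π (C u * X 0 + C v * X 1) = 0 :=
      Ideal.Quotient.eq_zero_iff_mem.2 (Ideal.mem_span_singleton_self _)
    rw [map_add, map_mul, map_mul, ← algebraMap_eq, AlgHom.commutes, AlgHom.commutes] at this
    exact this
  have h0 : MvPolynomial.aeval
      (fun i => algebraMap K (MvPolynomial (Fin 2) K ⧸ I) (![-v, u] i)) f = 0 := by
    have := aeval_algebraMap_apply (MvPolynomial (Fin 2) K ⧸ I) ![-v, u] f
    rw [aeval_eq_eval, h, map_zero] at this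
    exact this
  have key : ∀ (k : K) (c : MvPolynomial (Fin 2) K ⧸ I), k ≠ 0 →
      (∀ i, algebraMap K _ k * π (X i) = c * algebraMap K _ (![-v, u] i)) → π f = 0 := by
    intro k c hk hc
    have h1 := hf.aeval_mul_left (algebraMap K _ k) fun i => π (X i)
    rw [_root_.funext hc, hf.aeval_mul_left, h0, mul_zero, ← hπ] at h1
    exact (((hk.isUnit.map (algebraMap K _)).pow n).mul_right_eq_zero).1 h1.symm
  have hf0 : π f = 0 := by
    obtain hu | hv := huv
    · refine key u (π (X 1)) hu (Fin.forall_fin_two.2 ⟨?_, ?_⟩)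
      · simp only [Matrix.cons_val_zero, map_neg]
        linear_combination hL
      · simp only [Matrix.cons_val_one, Matrix.cons_val_fin_one]
        ring
    · refine key v (-π (X 0)) hv (Fin.forall_fin_two.2 ⟨?_, ?_⟩)
      · simp only [Matrix.cons_val_zero, map_neg]
        ring
      · simp only [Matrix.cons_val_one, Matrix.cons_val_fin_one]
        linear_combination hL
  exact Ideal.mem_span_singleton.1 (Ideal.Quotient.eq_zero_iff_mem.1 hf0)

/-- The coefficients of a product of two affine linear forms in two variables. -/
theorem coeffs_eq_of_forall_eq_mul_linear {K : Type*} [Field K] [CharZero K]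
    {c00 c10 c01 c20 c11 c02 u v w r s t : K}
    (h : ∀ x y : K, c00 + c10 * x + c01 * y + c20 * x ^ 2 + 2 * c11 * x * y + c02 * y ^ 2
      = (u * x + v * y + w) * (r * x + s * y + t)) :
    c00 = w * t ∧ c10 = u * t + w * r ∧ c01 = v * t + w * s ∧ c20 = u * r ∧
      c11 = (u * s + v * r) / 2 ∧ c02 = v * s := by
  have h00 := h 0 0
  have h10 := h 1 0
  have h10' := h (-1) 0
  have h01 := h 0 1
  have h01' := h 0 (-1)
  have h11 := h 1 1
  refine ⟨?_, ?_, ?_, ?_, ?_, ?_⟩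
  · linear_combination h00
  · linear_combination (h10 - h10') / 2
  · linear_combination (h01 - h01') / 2
  · linear_combination (h10 + h10') / 2 - h00
  · linear_combination (h11 - h10 - h01 + h00) / 2
  · linear_combination (h01 + h01') / 2 - h00

/-- For a quadratic system with coefficients `aᵢⱼ, bᵢⱼ`, define
`D(x,y) = 4Δ(−y,x)` (where `Δ(α,β)` is the determinant of the symmetric matrix of the conic
`αP + βQ`) and `C₂(x,y) = y·p₂ − x·q₂`. If the system has invariant lines in `m ≤ 3`
pairwise distinct directions `(uᵢ, vᵢ)`, then each point `(−vᵢ, uᵢ)` is a common zero of the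
cubic forms `C₂` and `D`, i.e. the `m` pairwise non-proportional linear forms `uᵢx + vᵢy`
are distinct common factors of `C₂` and `D`. -/
theorem directions_of_invariant_lines_common_factors
    (a00 a10 a01 a20 a11 a02 b00 b10 b01 b20 b11 b02 : ℂ)
    (m : ℕ) (hm : m ≤ 3) (uv : Fin m → ℂ × ℂ)
    (hnz : ∀ i, uv i ≠ (0, 0))
    (hdist : ∀ i j, i ≠ j → ∀ c : ℂ, uv i ≠ (c * (uv j).1, c * (uv j).2))
    (hinv : ∀ i, ∃ w r s t : ℂ,
      C (uv i).1 * (C a00 + C a10 * X 0 + C a01 * X 1 + C a20 * X 0 ^ 2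
          + C (2 * a11) * X 0 * X 1 + C a02 * X 1 ^ 2)
      + C (uv i).2 * (C b00 + C b10 * X 0 + C b01 * X 1 + C b20 * X 0 ^ 2
          + C (2 * b11) * X 0 * X 1 + C b02 * X 1 ^ 2)
      = (C (uv i).1 * X 0 + C (uv i).2 * X 1 + C w)
          * (C r * X 0 + C s * X 1 + C t)) :
    let α : MvPolynomial (Fin 2) ℂ := - X 1
    let β : MvPolynomial (Fin 2) ℂ := X 0
    let Dp : MvPolynomial (Fin 2) ℂ := 4 * Matrix.det
      !![α * C a20 + β * C b20, α * C a11 + β * C b11,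
           C (1/2 : ℂ) * (α * C a10 + β * C b10);
         α * C a11 + β * C b11, α * C a02 + β * C b02,
           C (1/2 : ℂ) * (α * C a01 + β * C b01);
         C (1/2 : ℂ) * (α * C a10 + β * C b10), C (1/2 : ℂ) * (α * C a01 + β * C b01),
           α * C a00 + β * C b00]
    let C2p : MvPolynomial (Fin 2) ℂ :=
      X 1 * (C a20 * X 0 ^ 2 + C (2 * a11) * X 0 * X 1 + C a02 * X 1 ^ 2)
        - X 0 * (C b20 * X 0 ^ 2 + C (2 * b11) * X 0 * X 1 + C b02 * X 1 ^ 2)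
    ∀ i, eval ![-(uv i).2, (uv i).1] Dp = 0 ∧ eval ![-(uv i).2, (uv i).1] C2p = 0 ∧
      (C (uv i).1 * X 0 + C (uv i).2 * X 1) ∣ Dp ∧
      (C (uv i).1 * X 0 + C (uv i).2 * X 1) ∣ C2p := by
  intro α β Dp C2p i
  obtain ⟨w, r, s, t, h⟩ := hinv i
  have hne : (uv i).1 ≠ 0 ∨ (uv i).2 ≠ 0 := by
    by_contra! hc
    exact hnz i (Prod.ext hc.1 hc.2)
  generalize (uv i).1 = u at *
  generalize (uv i).2 = v at *
  obtain ⟨h00, h10, h01, h20, h11, h02⟩ := coeffs_eq_of_forall_eq_mul_linear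
    (c00 := u * a00 + v * b00) (c10 := u * a10 + v * b10) (c01 := u * a01 + v * b01)
    (c20 := u * a20 + v * b20) (c11 := u * a11 + v * b11) (c02 := u * a02 + v * b02)
    (u := u) (v := v) (w := w) (r := r) (s := s) (t := t) fun x y => by
      have := congrArg (eval fun k : ℕ => if k = 0 then x else y) h
      simp only [map_add, map_mul, map_pow, eval_C, eval_X, one_ne_zero, if_true,
        if_false] at this
      linear_combination this
  have hD : eval ![-v, u] Dp = 0 := by
    have hdet : eval ![-v, u] Dp = -((u * a00 + v * b00) *
        (4 * (u * a20 + v * b20) * (u * a02 + v * b02) - 4 * (u * a11 + v * b11) ^ 2)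
        - (u * a20 + v * b20) * (u * a01 + v * b01) ^ 2
        - (u * a02 + v * b02) * (u * a10 + v * b10) ^ 2
        + 2 * (u * a11 + v * b11) * (u * a10 + v * b10) * (u * a01 + v * b01)) := by
      simp [Dp, α, β, Matrix.det_fin_three]
      ring
    rw [hdet, h00, h10, h01, h20, h11, h02]
    ring
  have hC : eval ![-v, u] C2p = 0 := by
    simp [C2p]
    linear_combination v ^ 2 * h20 - 2 * u * v * h11 + u ^ 2 * h02
  have hlin : ∀ a b : ℂ, (α * C a + β * C b).IsHomogeneous 1 := fun a b =>
    ((isHomogeneous_X _ _).neg.mul (isHomogeneous_C _ a)).add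
      ((isHomogeneous_X _ _).mul (isHomogeneous_C _ b))
  have hDhom : Dp.IsHomogeneous 3 := by
    refine IsHomogeneous.C_mul (IsHomogeneous.det fun i j => ?_) 4
    fin_cases i <;> fin_cases j <;>
      first
        | exact hlin _ _
        | exact (hlin _ _).C_mul _
  have hquad : ∀ a b c : ℂ, (C a * X 0 ^ 2 + C b * X 0 * X 1 + C c * X 1 ^ 2 :
      MvPolynomial (Fin 2) ℂ).IsHomogeneous 2 := fun a b c =>
    ((isHomogeneous_C_mul_X_pow _ _ _).add
      ((isHomogeneous_C_mul_X _ _).mul (isHomogeneous_X _ _))).add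
      (isHomogeneous_C_mul_X_pow _ _ _)
  have hChom : C2p.IsHomogeneous 3 :=
    ((isHomogeneous_X _ 1).mul (hquad _ _ _)).sub ((isHomogeneous_X _ 0).mul (hquad _ _ _))
  exact ⟨hD, hC, hDhom.linear_dvd_of_eval_eq_zero_s19 hne hD,
    hChom.linear_dvd_of_eval_eq_zero_s19 hne hC⟩
end
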